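/- Let G be a finite tree with vertex set V(G) and let ≼ be a perfect elimination ordering of G. Let S ⊆ V(G) be a monophonically convex set of diameter exactly 2 (so the subtree induced by S is a star). Let I be a nonempty finite index set and for each i ∈ I let H_i ⊆ S be a nonempty monophonically convex set, such that ⋂_{i ∈ I} H_i ≠ ∅. For each i ∈ I define y_i to be the ≼-maximum element of cent(H_i). Then d(y_i, y_j) ≤ 1 for all i, j ∈ I. -/

import Mathlib

open SimpleGraph

/-- A walk is a chordless (induced/minimal) path: it is a path and any two of
its vertices adjacent in `G` are adjacent along the walk itself. -/
def IsChordlessPath {V : Type*} {G : SimpleGraph V} {u v : V}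
    (p : G.Walk u v) : Prop :=
  p.IsPath ∧ ∀ a ∈ p.support, ∀ b ∈ p.support, G.Adj a b → p.toSubgraph.Adj a b

/-- A vertex set is monophonically convex: it contains every vertex of every
chordless path between two of its members. -/
def MonoConvex {V : Type*} (G : SimpleGraph V) (U : Set V) : Prop :=
  ∀ u ∈ U, ∀ v ∈ U, ∀ p : G.Walk u v, IsChordlessPath p →
    ∀ w ∈ p.support, w ∈ U

/-- Eccentricity of `u` within the vertex set `S` (distances in `G`). -/
noncomputable def eccIn {V : Type*} (G : SimpleGraph V) (S : Finset V) (u : V) : ℕ :=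
  S.sup (fun v => G.dist u v)

/-- Center of the vertex set `S`: its members of minimum eccentricity. -/
noncomputable def centIn {V : Type*} (G : SimpleGraph V) (S : Finset V) : Set V :=
  {u ∈ (↑S : Set V) | ∀ v ∈ S, eccIn G S u ≤ eccIn G S v}

/-- Diameter of a vertex set: maximum pairwise distance in `G`. -/
noncomputable def diamIn {V : Type*} (G : SimpleGraph V) (S : Finset V) : ℕ :=
  S.sup fun u => S.sup fun v => G.dist u v

/-- The ambient linear order is a perfect elimination ordering of `G`: for
every `u`, the later neighbours of `u` form a clique. -/
def IsPEO {V : Type*} [LinearOrder V] (G : SimpleGraph V) : Prop :=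
  ∀ u v w : V, G.Adj u v → G.Adj u w → u ≤ v → u ≤ w → v ≠ w → G.Adj v w

/-- Vertices at distance two have a common neighbour. -/
theorem SimpleGraph.Connected.exists_adj_adj_of_dist_eq_two {V : Type*} {G : SimpleGraph V}
    (hG : G.Connected) {a b : V} (hab : G.dist a b = 2) : ∃ c, G.Adj a c ∧ G.Adj c b := by
  obtain ⟨p, hp⟩ := hG.exists_walk_length_eq_dist a b
  rw [hab] at hp
  match p, hp with
  | .cons h₁ (.cons h₂ .nil), _ => exact ⟨_, h₁, h₂⟩

/-- In a tree, a vertex has at most one neighbour closer to a given vertex. -/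
theorem SimpleGraph.IsTree.eq_of_adj_of_dist_eq {V : Type*} {G : SimpleGraph V} (hG : G.IsTree)
    {v a b c : V} (hac : G.Adj a c) (hbc : G.Adj b c) (ha : G.dist v c = G.dist v a + 1)
    (hb : G.dist v c = G.dist v b + 1) : a = b := by
  obtain ⟨p, hp⟩ := hG.connected.exists_walk_length_eq_dist v a
  obtain ⟨q, hq⟩ := hG.connected.exists_walk_length_eq_dist v b
  have hp' : (p.concat hac).IsPath :=
    (p.concat hac).isPath_of_length_eq_dist (by rw [Walk.length_concat, hp, ha])
  have hq' : (q.concat hbc).IsPath :=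
    (q.concat hbc).isPath_of_length_eq_dist (by rw [Walk.length_concat, hq, hb])
  have h := congrArg (fun r : G.Path v c => r.1.penultimate)
    ((hG.isAcyclic.subsingleton_path v c).elim ⟨_, hp'⟩ ⟨_, hq'⟩)
  simpa using h

/-- In a tree, the middle of a path of length two is within distance one of every vertex that is
within distance two of both ends. -/
theorem SimpleGraph.IsTree.dist_le_one_of_dist_le_two {V : Type*} {G : SimpleGraph V}
    (hG : G.IsTree) {v a b c : V} (hac : G.Adj a c) (hbc : G.Adj b c) (hab : a ≠ b)
    (ha : G.dist v a ≤ 2) (hb : G.dist v b ≤ 2) : G.dist v c ≤ 1 := by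
  by_contra! hc
  have h₁ := hG.dist_eq_dist_add_one_of_adj v hac
  have h₂ := hG.dist_eq_dist_add_one_of_adj v hbc
  exact hab (hG.eq_of_adj_of_dist_eq (v := v) hac hbc (by omega) (by omega))

/-- In a tree, adjacent vertices have no common neighbour. -/
theorem SimpleGraph.IsTree.not_adj_of_adj_adj {V : Type*} {G : SimpleGraph V} (hG : G.IsTree)
    {a b c : V} (hac : G.Adj a c) (hcb : G.Adj c b) : ¬ G.Adj a b := fun hab =>
  hG.dist_ne_of_adj a hcb ((dist_eq_one_iff_adj.2 hac).trans (dist_eq_one_iff_adj.2 hab).symm)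

/-- In a tree, a monophonically convex set containing two neighbours of `c` contains `c`. -/
theorem MonoConvex.mem_of_adj_adj {V : Type*} {G : SimpleGraph V} (hG : G.IsTree) {U : Set V}
    (hU : MonoConvex G U) {a b c : V} (ha : a ∈ U) (hb : b ∈ U) (hab : a ≠ b) (hac : G.Adj a c)
    (hcb : G.Adj c b) : c ∈ U := by
  have hnab := hG.not_adj_of_adj_adj hac hcb
  refine hU a ha b hb (.cons hac (.cons hcb .nil)) ⟨?_, ?_⟩ c (by simp)
  · simp [Walk.isPath_def, hac.ne, hcb.ne, hab]
  · have hnba : ¬ G.Adj b a := fun h => hnab h.symm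
    intro x hx y hy hxy
    simp only [Walk.support_cons, Walk.support_nil, List.mem_cons, List.not_mem_nil,
      or_false] at hx hy
    rcases hx with rfl | rfl | rfl <;> rcases hy with rfl | rfl | rfl <;>
      simp_all [Walk.toSubgraph, Subgraph.sup_adj, subgraphOfAdj_adj]

theorem dist_le_diamIn {V : Type*} (G : SimpleGraph V) {S : Finset V} {u v : V} (hu : u ∈ S)
    (hv : v ∈ S) : G.dist u v ≤ diamIn G S :=
  (Finset.le_sup (f := fun v => G.dist u v) hv).trans
    (Finset.le_sup (f := fun u => S.sup fun v => G.dist u v) hu)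

theorem dist_le_eccIn {V : Type*} (G : SimpleGraph V) {S : Finset V} (u : V) {v : V}
    (hv : v ∈ S) : G.dist u v ≤ eccIn G S u :=
  Finset.le_sup (f := fun v => G.dist u v) hv

/-- A vertex adjacent to a central vertex and of eccentricity at most one is central. -/
theorem mem_centIn_of_adj {V : Type*} {G : SimpleGraph V} {S : Finset V} {a c : V}
    (ha : a ∈ centIn G S) (hc : c ∈ S) (hac : G.Adj a c) (hecc : eccIn G S c ≤ 1) :
    c ∈ centIn G S := by
  refine ⟨hc, fun v hv => ?_⟩
  have h₁ := dist_le_eccIn G a hc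
  rw [dist_eq_one_iff_adj.2 hac] at h₁
  exact (hecc.trans h₁).trans (ha.2 v hv)

/-- in a tree with a perfect elimination ordering, if `S` is a
monophonically convex set of diameter exactly `2` containing nonempty
monophonically convex sets `H i` with a common element, and `y i` is the
`≼`-maximum element of `cent(H i)`, then `d(y i, y j) ≤ 1` for all `i, j`. -/
theorem stmt11 {V : Type*} [Fintype V] [DecidableEq V] [LinearOrder V]
    (G : SimpleGraph V) (hG : G.IsTree) (hpeo : IsPEO G)
    (S : Finset V) (hSconv : MonoConvex G (↑S : Set V))
    (hSdiam : diamIn G S = 2)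
    {ι : Type*} [Fintype ι] [Nonempty ι]
    (H : ι → Finset V) (hHsub : ∀ i, H i ⊆ S) (hHne : ∀ i, (H i).Nonempty)
    (hHconv : ∀ i, MonoConvex G (↑(H i) : Set V))
    (hint : (⋂ i, (↑(H i) : Set V)).Nonempty)
    (y : ι → V) (hy : ∀ i, IsGreatest (centIn G (H i)) (y i)) :
    ∀ i j, G.dist (y i) (y j) ≤ 1 := by
  intro i j
  set a := y i
  set b := y j
  have hai : a ∈ centIn G (H i) := (hy i).1
  have hbj : b ∈ centIn G (H j) := (hy j).1
  have hS : ∀ u ∈ S, ∀ v ∈ S, G.dist u v ≤ 2 := fun u hu v hv =>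
    hSdiam ▸ dist_le_diamIn G hu hv
  have haS : a ∈ S := hHsub i hai.1
  have hbS : b ∈ S := hHsub j hbj.1
  by_contra! hlt
  have hdist : G.dist a b = 2 := le_antisymm (hS a haS b hbS) hlt
  have hab : a ≠ b := by
    intro h
    simp [h] at hdist
  have hnab : ¬ G.Adj a b := by
    intro h
    simp [dist_eq_one_iff_adj.2 h] at hdist
  obtain ⟨c, hac, hcb⟩ := hG.connected.exists_adj_adj_of_dist_eq_two hdist
  have hc : ∀ v ∈ S, G.dist c v ≤ 1 := fun v hv => by
    rw [SimpleGraph.dist_comm]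
    exact hG.dist_le_one_of_dist_le_two hac hcb.symm hab (hS v hv a haS) (hS v hv b hbS)
  have hecc : ∀ k, eccIn G (H k) c ≤ 1 := fun k =>
    Finset.sup_le fun v hv => hc v (hHsub k hv)
  have hmem : ∀ k, ∀ x ∈ H k, ∀ z ∈ H k, G.Adj x c → z ≠ x → c ∈ H k := by
    intro k x hx z hz hxc hzx
    by_cases hzc : c = z
    · rwa [hzc]
    · have h₁ := hG.connected.pos_dist_of_ne hzc
      have h₂ := hc z (hHsub k hz)
      have h₃ : G.Adj c z := dist_eq_one_iff_adj.1 (by omega)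
      exact (hHconv k).mem_of_adj_adj hG hx hz hzx.symm hxc h₃
  have hfar : ∀ k, ∀ x ∈ centIn G (H k), c ∈ H k → ∀ z ∈ H k, G.dist x z ≤ 1 :=
    fun k x hx hck z hz => (dist_le_eccIn G x hz).trans ((hx.2 c hck).trans (hecc k))
  obtain ⟨z, hz⟩ := hint
  have hzH : ∀ k, z ∈ H k := fun k => Set.mem_iInter.1 hz k
  have hci : c ∈ H i := by
    by_contra hci
    have hza : z = a := by
      by_contra hza
      exact hci (hmem i a hai.1 z (hzH i) hac hza)
    have haj : a ∈ H j := hza ▸ hzH j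
    have h := hfar j b hbj (hmem j b hbj.1 a haj hcb.symm hab) a haj
    rw [SimpleGraph.dist_comm] at h
    omega
  have hcj : c ∈ H j := by
    by_contra hcj
    have hzb : z = b := by
      by_contra hzb
      exact hcj (hmem j b hbj.1 z (hzH j) hcb.symm hzb)
    have h := hfar i a hai hci b (hzb ▸ hzH i)
    omega
  have hca : c ≤ a := (hy i).2 (mem_centIn_of_adj hai hci hac (hecc i))
  have hcb' : c ≤ b := (hy j).2 (mem_centIn_of_adj hbj hcj hcb.symm (hecc j))
  exact hnab (hpeo c a b hac.symm hcb hca hcb' hab)
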